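/- arXiv:2402.06108 — 3 statements merged into one kernel-verified Lean document; each statement's English description precedes it below -/
import Mathlib

section
/- Let G¹ and G² be real symmetric N×N matrices and G¹² a real N×N matrix, and let G⧉ be the supra-adjacency matrix with off-diagonal blocks G¹² and G²¹ = (G¹²)ᵀ. If ‖G¹²‖₂ < 1 + λ_min(G¹) and ‖G¹²‖₂ < 1 + λ_min(G²), then I + G⧉ is positive definite, and hence a P-matrix (so the multilayer network game has a unique Nash equilibrium). -/
/-- `M` is a P-matrix: every principal submatrix (obtained by keeping the rows and
columns indexed by a set `s`) has strictly positive determinant. -/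
def IsPMatrix {m : Type*} [Fintype m] [DecidableEq m] (M : Matrix m m ℝ) : Prop :=
  ∀ s : Finset m,
    0 < (M.submatrix (fun i : s => (i : m)) (fun j : s => (j : m))).det

/-- `z` is a solution of the linear complementarity problem LCP(M, b). -/
def IsLCPSolution {m : Type*} [Fintype m] (M : Matrix m m ℝ) (b z : m → ℝ) : Prop :=
  (∀ i, 0 ≤ z i) ∧ (∀ i, 0 ≤ M.mulVec z i + b i) ∧ (∀ i, z i * (M.mulVec z i + b i) = 0)

/-- The smallest eigenvalue of a real symmetric (Hermitian) matrix. -/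
noncomputable def eigMin {m : Type*} [Fintype m] [DecidableEq m] {A : Matrix m m ℝ}
    (hA : A.IsHermitian) : ℝ := ⨅ i, hA.eigenvalues i

/-- The largest eigenvalue of a real symmetric (Hermitian) matrix. -/
noncomputable def eigMax {m : Type*} [Fintype m] [DecidableEq m] {A : Matrix m m ℝ}
    (hA : A.IsHermitian) : ℝ := ⨆ i, hA.eigenvalues i

/-- The spectral (operator 2-) norm of a real matrix. -/
noncomputable def specNorm {m : Type*} [Fintype m] [DecidableEq m] (A : Matrix m m ℝ) : ℝ :=
  ‖Matrix.toEuclideanCLM (𝕜 := ℝ) A‖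

section

open Matrix

variable {m : Type*} [Fintype m] [DecidableEq m]

theorem Matrix.IsHermitian.eigMin_le_eigenvalues {A : Matrix m m ℝ} (hA : A.IsHermitian) (i : m) :
    eigMin hA ≤ hA.eigenvalues i :=
  ciInf_le (Set.finite_range _).bddBelow i

theorem Matrix.IsHermitian.posSemidef_sub_eigMin {A : Matrix m m ℝ} (hA : A.IsHermitian) :
    (A - algebraMap ℝ (Matrix m m ℝ) (eigMin hA)).PosSemidef := by
  rw [Matrix.posSemidef_iff_isHermitian_and_spectrum_nonneg]
  refine ⟨hA.sub ?_, fun x hx => ?_⟩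
  · rw [Algebra.algebraMap_eq_smul_one]
    exact isHermitian_one.smul (IsSelfAdjoint.all _)
  · have hmem : x + eigMin hA ∈ spectrum ℝ A := by
      simpa [spectrum.mem_iff, sub_sub_eq_add_sub] using hx
    obtain ⟨i, hi⟩ := hA.spectrum_real_eq_range_eigenvalues ▸ hmem
    have := hA.eigMin_le_eigenvalues i
    simp only [Set.mem_ofPred_eq]
    linarith

theorem Matrix.IsHermitian.eigMin_mul_dotProduct_le {A : Matrix m m ℝ} (hA : A.IsHermitian)
    (x : m → ℝ) : eigMin hA * (x ⬝ᵥ x) ≤ x ⬝ᵥ A *ᵥ x := by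
  have h := hA.posSemidef_sub_eigMin.dotProduct_mulVec_nonneg x
  simpa [Algebra.algebraMap_eq_smul_one, sub_mulVec, smul_mulVec] using h

theorem specNorm_nonneg (A : Matrix m m ℝ) : 0 ≤ specNorm A := norm_nonneg _

theorem two_mul_abs_dotProduct_mulVec_le (A : Matrix m m ℝ) (x y : m → ℝ) :
    2 * |x ⬝ᵥ A *ᵥ y| ≤ specNorm A * (x ⬝ᵥ x + y ⬝ᵥ y) := by
  have hsq (v : m → ℝ) : v ⬝ᵥ v = ‖WithLp.toLp 2 v‖ ^ 2 := by
    rw [← real_inner_self_eq_norm_sq, EuclideanSpace.inner_eq_star_dotProduct]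
    simp
  set u := WithLp.toLp 2 x
  set v := WithLp.toLp 2 y
  have h : |x ⬝ᵥ A *ᵥ y| ≤ ‖u‖ * (specNorm A * ‖v‖) := by
    have hin : inner ℝ u (toEuclideanCLM (𝕜 := ℝ) A v) = x ⬝ᵥ A *ᵥ y :=
      inner_toEuclideanCLM A u v
    rw [← hin]
    exact (abs_real_inner_le_norm _ _).trans
      (mul_le_mul_of_nonneg_left (ContinuousLinearMap.le_opNorm _ _) (norm_nonneg _))
  rw [hsq x, hsq y]
  nlinarith [mul_nonneg (specNorm_nonneg A) (sq_nonneg (‖u‖ - ‖v‖))]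

theorem Matrix.PosDef.isPMatrix {M : Matrix m m ℝ} (hM : M.PosDef) : IsPMatrix M := fun _ =>
  (hM.submatrix Subtype.val_injective).det_pos

/-- The variational inequality over the nonnegative orthant implies complementarity. -/
theorem isLCPSolution_of_variational {M : Matrix m m ℝ} {b z : m → ℝ} (hz : ∀ i, 0 ≤ z i)
    (h : ∀ w : m → ℝ, (∀ i, 0 ≤ w i) → 0 ≤ (M *ᵥ z + b) ⬝ᵥ (w - z)) : IsLCPSolution M b z := by
  have hr (i : m) : 0 ≤ (M *ᵥ z) i + b i := by
    have := h (z + Pi.single i 1) fun j =>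
      add_nonneg (hz j) ((Pi.single_nonneg (α := fun _ => ℝ)).2 zero_le_one j)
    simpa using this
  refine ⟨hz, hr, fun i => le_antisymm ?_ (mul_nonneg (hz i) (hr i))⟩
  have hw := h (z - Pi.single i (z i)) fun j => by
    rcases eq_or_ne j i with rfl | hj <;> simp [*]
  simpa [mul_comm] using hw

theorem Matrix.PosDef.exists_isUnit_eq_transpose_mul_self {M : Matrix m m ℝ} (hM : M.PosDef) :
    ∃ B : Matrix m m ℝ, IsUnit B ∧ M = Bᵀ * B := by
  open scoped MatrixOrder in
  obtain ⟨B, rfl⟩ := CStarAlgebra.nonneg_iff_eq_star_mul_self.mp hM.posSemidef.nonneg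
  refine ⟨B, ?_, by simp [star_eq_conjTranspose]⟩
  have h := hM.isUnit
  rw [isUnit_iff_isUnit_det] at h ⊢
  exact isUnit_of_mul_isUnit_right (det_mul (star B) B ▸ h)

theorem Matrix.PosDef.exists_isLCPSolution {M : Matrix m m ℝ} (hM : M.PosDef) (b : m → ℝ) :
    ∃ z, IsLCPSolution M b z := by
  obtain ⟨B, hB, rfl⟩ := hM.exists_isUnit_eq_transpose_mul_self
  have hdet : IsUnit B.det := (isUnit_iff_isUnit_det B).1 hB
  have hdetT : IsUnit Bᵀ.det := by rwa [det_transpose]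
  let T := toEuclideanCLM (𝕜 := ℝ) B⁻¹
  let K : Set (EuclideanSpace ℝ m) := {y | ∀ i, 0 ≤ T y i}
  have hclosed : IsClosed K := by
    simp only [K, Set.ofPred_forall]
    exact isClosed_iInter fun i => isClosed_le continuous_const (by fun_prop)
  have hconv : Convex ℝ K := fun x hx y hy s t hs ht _ i => by
    simpa using add_nonneg (mul_nonneg hs (hx i)) (mul_nonneg ht (hy i))
  have hne : K.Nonempty := ⟨0, fun i => by simp⟩
  let u : EuclideanSpace ℝ m := WithLp.toLp 2 (-((Bᵀ)⁻¹ *ᵥ b))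
  obtain ⟨y, hy, hmin⟩ := exists_norm_eq_iInf_of_complete_convex hne hclosed.isComplete hconv u
  rw [norm_eq_iInf_iff_real_inner_le_zero hconv hy] at hmin
  refine ⟨B⁻¹ *ᵥ y.ofLp, isLCPSolution_of_variational hy fun w hw => ?_⟩
  have hvar := hmin (WithLp.toLp 2 (B *ᵥ w)) fun i => by
    simpa [T, mulVec_mulVec, nonsing_inv_mul B hdet] using hw i
  have hBy : B *ᵥ w - y.ofLp = B *ᵥ (w - B⁻¹ *ᵥ y.ofLp) := by
    rw [mulVec_sub, mulVec_mulVec, mul_nonsing_inv B hdet, one_mulVec]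
  have hu : (u - y).ofLp ᵥ* B = -((Bᵀ * B) *ᵥ (B⁻¹ *ᵥ y.ofLp) + b) := by
    rw [← mulVec_transpose, mulVec_mulVec, Matrix.mul_assoc, mul_nonsing_inv B hdet, Matrix.mul_one]
    simp only [u, WithLp.ofLp_sub, mulVec_sub, mulVec_neg, mulVec_mulVec,
      mul_nonsing_inv _ hdetT, one_mulVec]
    abel
  rw [EuclideanSpace.inner_eq_star_dotProduct, star_trivial, dotProduct_comm,
    WithLp.ofLp_sub 2 (WithLp.toLp 2 (B *ᵥ w)), hBy, dotProduct_mulVec, hu, neg_dotProduct] at hvar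
  linarith

omit [DecidableEq m] in
theorem Matrix.PosDef.isLCPSolution_unique {M : Matrix m m ℝ} (hM : M.PosDef) {b z w : m → ℝ}
    (hz : IsLCPSolution M b z) (hw : IsLCPSolution M b w) : z = w := by
  by_contra hne
  have hpos := hM.dotProduct_mulVec_pos (sub_ne_zero.2 hne)
  refine hpos.not_ge (Finset.sum_nonpos fun i _ => ?_)
  simp only [star_trivial, mulVec_sub, Pi.sub_apply]
  nlinarith [hz.2.2 i, hw.2.2 i, mul_nonneg (hz.1 i) (hw.2.1 i), mul_nonneg (hw.1 i) (hz.2.1 i)]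

theorem Matrix.PosDef.existsUnique_isLCPSolution {M : Matrix m m ℝ} (hM : M.PosDef) (b : m → ℝ) :
    ∃! z, IsLCPSolution M b z :=
  let ⟨z, hz⟩ := hM.exists_isLCPSolution b
  ⟨z, hz, fun _ hw => hM.isLCPSolution_unique hw hz⟩

theorem posDef_one_add_fromBlocks {G1 G2 G12 : Matrix m m ℝ}
    (hG1 : G1.IsHermitian) (hG2 : G2.IsHermitian)
    (h1 : specNorm G12 < 1 + eigMin hG1) (h2 : specNorm G12 < 1 + eigMin hG2) :
    (1 + fromBlocks G1 G12 G12ᵀ G2).PosDef := by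
  refine .of_dotProduct_mulVec_pos
    (isHermitian_one.add (hG1.fromBlocks (by simp) hG2)) fun x hx => ?_
  obtain ⟨u, v, rfl⟩ : ∃ u v : m → ℝ, x = Sum.elim u v :=
    ⟨x ∘ Sum.inl, x ∘ Sum.inr, (Sum.elim_comp_inl_inr x).symm⟩
  have hcross : v ⬝ᵥ G12ᵀ *ᵥ u = u ⬝ᵥ G12 *ᵥ v := by
    rw [mulVec_transpose, dotProduct_comm, ← dotProduct_mulVec]
  have hexp : Sum.elim u v ⬝ᵥ (1 + fromBlocks G1 G12 G12ᵀ G2) *ᵥ Sum.elim u v =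
      u ⬝ᵥ u + v ⬝ᵥ v + u ⬝ᵥ G1 *ᵥ u + v ⬝ᵥ G2 *ᵥ v + 2 * (u ⬝ᵥ G12 *ᵥ v) := by
    simp only [add_mulVec, one_mulVec, fromBlocks_mulVec, dotProduct_add, Sum.elim_comp_inl,
      Sum.elim_comp_inr, sumElim_dotProduct_sumElim, hcross]
    ring
  rw [star_trivial, hexp]
  have hu0 : 0 ≤ u ⬝ᵥ u := by simpa using dotProduct_star_self_nonneg u
  have hv0 : 0 ≤ v ⬝ᵥ v := by simpa using dotProduct_star_self_nonneg v
  have hsum : 0 < (1 + eigMin hG1 - specNorm G12) * (u ⬝ᵥ u) +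
      (1 + eigMin hG2 - specNorm G12) * (v ⬝ᵥ v) := by
    rcases hu0.lt_or_eq with hu | hu
    · exact add_pos_of_pos_of_nonneg (mul_pos (by linarith) hu) (mul_nonneg (by linarith) hv0)
    · have hu : u = 0 := dotProduct_self_eq_zero.1 hu.symm
      have hv : v ≠ 0 := by
        rintro rfl
        exact hx (by simp [hu])
      have hv' : 0 < v ⬝ᵥ v := hv0.lt_of_ne fun h => hv (dotProduct_self_eq_zero.1 h.symm)
      exact add_pos_of_nonneg_of_pos (mul_nonneg (by linarith) hu0) (mul_pos (by linarith) hv')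
  linarith [hG1.eigMin_mul_dotProduct_le u, hG2.eigMin_mul_dotProduct_le v,
    two_mul_abs_dotProduct_mulVec_le G12 u v, neg_abs_le (u ⬝ᵥ G12 *ᵥ v)]

end

/-- For symmetric layers `G¹`, `G²` and off-diagonal blocks `G¹²` and
`(G¹²)ᵀ`, if `‖G¹²‖₂ < 1 + λ_min(G¹)` and `‖G¹²‖₂ < 1 + λ_min(G²)` then `I + G⧉` is
positive definite, hence a P-matrix, and the multilayer network game has a unique Nash
equilibrium. -/
theorem multilayer_posDef_of_bounded_interlayer {N : ℕ}
    (G1 G2 G12 : Matrix (Fin N) (Fin N) ℝ)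
    (hG1 : G1.IsHermitian) (hG2 : G2.IsHermitian)
    (h1 : specNorm G12 < 1 + eigMin hG1) (h2 : specNorm G12 < 1 + eigMin hG2) :
    (1 + Matrix.fromBlocks G1 G12 G12.transpose G2).PosDef ∧
      IsPMatrix (1 + Matrix.fromBlocks G1 G12 G12.transpose G2) ∧
      ∀ q : Fin N ⊕ Fin N → ℝ, ∃! z : Fin N ⊕ Fin N → ℝ,
        IsLCPSolution (1 + Matrix.fromBlocks G1 G12 G12.transpose G2) (-q) z :=
  have hM := posDef_one_add_fromBlocks hG1 hG2 h1 h2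
  ⟨hM, hM.isPMatrix, fun q => hM.existsUnique_isLCPSolution (-q)⟩
end

section
/- Let G¹ and G² be real symmetric N×N matrices with zero diagonal, let κ ∈ [0,1], and suppose all off-diagonal entries of G∥ = κ·G¹ + (1−κ)·G² are nonpositive (a multiplex game of strategic complements). If |κ·λ_min(G¹) + (1−κ)·λ_min(G²)| < 1, then ρ(G∥) < 1, and hence the multiplex network game has at least one (in fact a unique) Nash equilibrium. -/
open scoped ENNReal

/-- The spectral radius of a real matrix: the maximum modulus of its complex eigenvalues. -/
noncomputable def specRad {m : Type*} [Fintype m] [DecidableEq m] (A : Matrix m m ℝ) : ℝ≥0∞ :=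
  spectralRadius ℂ (A.map (algebraMap ℝ ℂ))

open Matrix in
theorem eigMin_mul_dotProduct_self_le {m : Type*} [Fintype m] [DecidableEq m]
    {A : Matrix m m ℝ} (hA : A.IsHermitian) (x : m → ℝ) :
    eigMin hA * (x ⬝ᵥ x) ≤ x ⬝ᵥ A *ᵥ x := by
  have hpsd : (A - algebraMap ℝ (Matrix m m ℝ) (eigMin hA)).PosSemidef := by
    refine Matrix.posSemidef_iff_isHermitian_and_spectrum_nonneg.2 ⟨?_, ?_⟩
    · refine hA.sub ?_
      rw [Matrix.algebraMap_eq_diagonal]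
      exact Matrix.isHermitian_diagonal _
    · rw [← spectrum.sub_singleton_eq, hA.spectrum_real_eq_range_eigenvalues]
      rintro _ ⟨_, ⟨i, rfl⟩, _, rfl, rfl⟩
      have hi : eigMin hA ≤ hA.eigenvalues i := ciInf_le (Set.finite_range _).bddBelow i
      exact sub_nonneg.2 hi
  have := hpsd.dotProduct_mulVec_nonneg x
  simp only [star_trivial, sub_mulVec, dotProduct_sub, Algebra.algebraMap_eq_smul_one,
    smul_mulVec, one_mulVec, dotProduct_smul, smul_eq_mul] at this
  linarith

open Matrix in
/-- A matrix with nonpositive entries attains its extreme quadratic forms on nonnegative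
vectors. -/
theorem abs_dotProduct_mulVec_le_of_nonpos {m : Type*} [Fintype m] {A : Matrix m m ℝ}
    (hA : ∀ i j, A i j ≤ 0) {c : ℝ} (hc : ∀ x : m → ℝ, c * (x ⬝ᵥ x) ≤ x ⬝ᵥ A *ᵥ x)
    (x : m → ℝ) : |x ⬝ᵥ A *ᵥ x| ≤ -c * (x ⬝ᵥ x) := by
  have h1 : |x ⬝ᵥ A *ᵥ x| ≤ -((fun i => |x i|) ⬝ᵥ A *ᵥ fun i => |x i|) := by
    simp only [dotProduct, mulVec, Finset.mul_sum, ← Finset.sum_neg_distrib]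
    refine (Finset.abs_sum_le_sum_abs _ _).trans (Finset.sum_le_sum fun i _ => ?_)
    refine (Finset.abs_sum_le_sum_abs _ _).trans (Finset.sum_le_sum fun j _ => ?_)
    rw [abs_mul, abs_mul, abs_of_nonpos (hA i j)]
    linarith
  have h2 := hc fun i => |x i|
  have h3 : ((fun i => |x i|) ⬝ᵥ fun i => |x i|) = x ⬝ᵥ x := by simp [dotProduct]
  rw [h3] at h2
  linarith

open Matrix in
theorem mulVec_dotProduct_self_le {m : Type*} [Fintype m] {A : Matrix m m ℝ}
    (hA : A.IsHermitian) {r : ℝ} (hr : 0 < r)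
    (h : ∀ x : m → ℝ, |x ⬝ᵥ A *ᵥ x| ≤ r * (x ⬝ᵥ x)) (x : m → ℝ) :
    (A *ᵥ x) ⬝ᵥ (A *ᵥ x) ≤ r ^ 2 * (x ⬝ᵥ x) := by
  have hT : Aᵀ = A := by simpa using hA.eq
  have h1 := (abs_le.1 (h (r • x + A *ᵥ x))).2
  have h2 := (abs_le.1 (h (r • x - A *ᵥ x))).1
  have hs : x ⬝ᵥ A *ᵥ (A *ᵥ x) = (A *ᵥ x) ⬝ᵥ (A *ᵥ x) := by
    rw [dotProduct_mulVec, ← mulVec_transpose, hT]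
  simp only [mulVec_add, mulVec_sub, mulVec_smul, dotProduct_add, add_dotProduct, dotProduct_sub,
    sub_dotProduct, smul_dotProduct, dotProduct_smul, smul_eq_mul, hs,
    dotProduct_comm (A *ᵥ x) x] at h1 h2
  have h3 : r * ((A *ᵥ x) ⬝ᵥ (A *ᵥ x)) ≤ r * (r ^ 2 * (x ⬝ᵥ x)) := by linarith
  exact le_of_mul_le_mul_left h3 hr

open Matrix in
theorem specRad_le_of_mulVec_dotProduct_self_le {m : Type*} [Fintype m] [DecidableEq m]
    {A : Matrix m m ℝ} {r : ℝ} (hr : 0 ≤ r)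
    (h : ∀ x : m → ℝ, (A *ᵥ x) ⬝ᵥ (A *ᵥ x) ≤ r ^ 2 * (x ⬝ᵥ x)) :
    specRad A ≤ ENNReal.ofReal r := by
  refine iSup₂_le fun μ hμ => ?_
  rw [← Matrix.spectrum_toLin', ← Module.End.hasEigenvalue_iff_mem_spectrum] at hμ
  obtain ⟨v, hv⟩ := hμ.exists_hasEigenvector
  have hv1 : A.map (algebraMap ℝ ℂ) *ᵥ v = μ • v := by simpa using hv.apply_eq_smul
  have hre : ∀ i, (A *ᵥ fun j => (v j).re) i = (μ * v i).re := fun i => by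
    simpa [mulVec, dotProduct] using congrArg Complex.re (congrFun hv1 i)
  have him : ∀ i, (A *ᵥ fun j => (v j).im) i = (μ * v i).im := fun i => by
    simpa [mulVec, dotProduct] using congrArg Complex.im (congrFun hv1 i)
  have hsum : ∑ i, Complex.normSq (μ * v i) ≤ r ^ 2 * ∑ i, Complex.normSq (v i) := by
    have := add_le_add (h fun j => (v j).re) (h fun j => (v j).im)
    simpa only [dotProduct, hre, him, ← mul_add, ← Finset.sum_add_distrib,
      ← Complex.normSq_apply] using this
  have hpos : 0 < ∑ i, Complex.normSq (v i) := by
    obtain ⟨i, hi⟩ := Function.ne_iff.1 hv.2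
    exact Finset.sum_pos' (fun i _ => Complex.normSq_nonneg _)
      ⟨i, Finset.mem_univ i, Complex.normSq_pos.2 hi⟩
  simp only [Complex.normSq_mul, ← Finset.mul_sum] at hsum
  have hle : ‖μ‖ ^ 2 ≤ r ^ 2 := by
    rw [← Complex.normSq_eq_norm_sq]
    exact le_of_mul_le_mul_right hsum hpos
  refine ENNReal.coe_le_coe.2 (NNReal.coe_le_coe.1 ?_)
  rw [coe_nnnorm, Real.coe_toNNReal r hr]
  exact (pow_le_pow_iff_left₀ (norm_nonneg μ) hr two_ne_zero).1 hle

open Matrix in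
theorem isLCPSolution_one_add_iff {m : Type*} [Fintype m] [DecidableEq m]
    (A : Matrix m m ℝ) (q z : m → ℝ) :
    IsLCPSolution (1 + A) (-q) z ↔ ∀ i, max 0 (q i - (A *ᵥ z) i) = z i := by
  simp only [IsLCPSolution, ← forall_and, add_mulVec, one_mulVec, Pi.add_apply, Pi.neg_apply]
  refine forall_congr' fun i => ⟨fun ⟨h1, h2, h3⟩ => ?_, fun hz => ?_⟩
  · rcases mul_eq_zero.1 h3 with h0 | h0
    · rw [max_eq_left] <;> linarith
    · rw [max_eq_right] <;> linarith
  · rcases max_cases 0 (q i - (A *ᵥ z) i) with ⟨h1, h2⟩ | ⟨h1, h2⟩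
    · have h0 : z i = 0 := by linarith
      exact ⟨h0.ge, by linarith, by rw [h0, zero_mul]⟩
    · have h0 : z i + (A *ᵥ z) i + -q i = 0 := by linarith
      exact ⟨by linarith, h0.ge, by rw [h0, mul_zero]⟩

open Matrix in
theorem existsUnique_isLCPSolution_one_add {m : Type*} [Fintype m] [DecidableEq m]
    {A : Matrix m m ℝ} {r : ℝ} (hr : 0 ≤ r) (hr1 : r < 1)
    (h : ∀ x : m → ℝ, (A *ᵥ x) ⬝ᵥ (A *ᵥ x) ≤ r ^ 2 * (x ⬝ᵥ x)) (q : m → ℝ) :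
    ∃! z, IsLCPSolution (1 + A) (-q) z := by
  let f : EuclideanSpace ℝ m → EuclideanSpace ℝ m := fun z =>
    WithLp.toLp 2 fun i => max 0 (q i - (A *ᵥ z.ofLp) i)
  have hf : ContractingWith ⟨r, hr⟩ f := by
    refine ⟨hr1, LipschitzWith.of_dist_le_mul fun z w => ?_⟩
    refine (abs_le_of_sq_le_sq' ?_ (mul_nonneg hr dist_nonneg)).2
    rw [mul_pow, EuclideanSpace.dist_eq, EuclideanSpace.dist_eq,
      Real.sq_sqrt (Finset.sum_nonneg fun _ _ => sq_nonneg _),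
      Real.sq_sqrt (Finset.sum_nonneg fun _ _ => sq_nonneg _)]
    have key := h (z.ofLp - w.ofLp)
    simp only [mulVec_sub, dotProduct, Pi.sub_apply, ← pow_two] at key
    simp only [Real.dist_eq, sq_abs]
    refine le_trans (Finset.sum_le_sum fun i _ => ?_) key
    refine sq_le_sq.2 ((abs_max_sub_max_le_max _ _ _ _).trans ?_)
    rw [sub_self, abs_zero, max_eq_right (abs_nonneg _), sub_sub_sub_cancel_left, abs_sub_comm]
  have hiff : ∀ z : EuclideanSpace ℝ m,
      IsLCPSolution (1 + A) (-q) z.ofLp ↔ Function.IsFixedPt f z := fun z => by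
    rw [isLCPSolution_one_add_iff]
    exact ⟨fun hz => PiLp.ext hz, fun hz i => congrFun (congrArg WithLp.ofLp hz) i⟩
  refine ⟨(hf.fixedPoint f).ofLp, (hiff _).2 hf.fixedPoint_isFixedPt, fun z hz => ?_⟩
  exact congrArg WithLp.ofLp (hf.fixedPoint_unique ((hiff (WithLp.toLp 2 z)).1 hz))

/-- For a multiplex game of strategic complements with symmetric
zero-diagonal layers, if `|κ λ_min(G¹) + (1−κ) λ_min(G²)| < 1` then `ρ(G∥) < 1`, and
hence the multiplex network game has a (unique) Nash equilibrium. -/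
theorem multiplex_complements_existence {N : ℕ} (G1 G2 : Matrix (Fin N) (Fin N) ℝ)
    (hG1 : G1.IsHermitian) (hG2 : G2.IsHermitian)
    (hd1 : ∀ i, G1 i i = 0) (hd2 : ∀ i, G2 i i = 0)
    (κ : ℝ) (hκ : κ ∈ Set.Icc (0 : ℝ) 1)
    (hcomp : ∀ i j, i ≠ j → (κ • G1 + (1 - κ) • G2) i j ≤ 0)
    (h : |κ * eigMin hG1 + (1 - κ) * eigMin hG2| < 1) :
    specRad (κ • G1 + (1 - κ) • G2) < 1 ∧
      ∀ q : Fin N → ℝ, ∃! z : Fin N → ℝ,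
        IsLCPSolution (1 + (κ • G1 + (1 - κ) • G2)) (-q) z := by
  have hnonpos : ∀ i j, (κ • G1 + (1 - κ) • G2) i j ≤ 0 := fun i j => by
    obtain rfl | hij := eq_or_ne i j
    · simp [hd1, hd2]
    · exact hcomp i j hij
  have hherm : (κ • G1 + (1 - κ) • G2).IsHermitian := by
    have h1 : G1.transpose = G1 := by simpa using hG1.eq
    have h2 : G2.transpose = G2 := by simpa using hG2.eq
    simp [Matrix.IsHermitian, h1, h2]
  have hlow : ∀ x : Fin N → ℝ, (κ * eigMin hG1 + (1 - κ) * eigMin hG2) * (x ⬝ᵥ x) ≤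
      x ⬝ᵥ (κ • G1 + (1 - κ) • G2).mulVec x := fun x => by
    have h1 := mul_le_mul_of_nonneg_left (eigMin_mul_dotProduct_self_le hG1 x) hκ.1
    have h2 := mul_le_mul_of_nonneg_left (eigMin_mul_dotProduct_self_le hG2 x)
      (sub_nonneg.2 hκ.2)
    simp only [Matrix.add_mulVec, Matrix.smul_mulVec, dotProduct_add, dotProduct_smul,
      smul_eq_mul]
    linarith
  obtain ⟨r, hcr, hr1⟩ := exists_between h
  have hr : 0 < r := (abs_nonneg _).trans_lt hcr
  have hbound := mulVec_dotProduct_self_le hherm hr fun x =>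
    (abs_dotProduct_mulVec_le_of_nonpos hnonpos hlow x).trans <|
      mul_le_mul_of_nonneg_right ((neg_le_abs _).trans hcr.le)
        (Finset.sum_nonneg fun i _ => mul_self_nonneg (x i))
  exact ⟨(specRad_le_of_mulVec_dotProduct_self_le hr.le hbound).trans_lt
    (ENNReal.ofReal_lt_one.2 hr1), existsUnique_isLCPSolution_one_add hr.le hr1 hbound⟩
end

section
/- Let G⁽¹⁾, …, G⁽ᴹ⁾ be real symmetric N×N matrices such that I + G⁽ˡ⁾ is a P-matrix for every l ∈ {1,…,M}, and let κ₁, …, κ_M be nonnegative weights with ∑_l κ_l = 1. Then I + ∑_{l=1}^{M} κ_l·G⁽ˡ⁾ is a P-matrix, so the M-layer multiplex network game has a unique Nash equilibrium. -/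
open Matrix in
/-- A real number `x ≤ 0` is not a root of the characteristic polynomial of a P-matrix. -/
theorem IsPMatrix.eval_charpoly_ne_zero {m : Type*} [Fintype m] [DecidableEq m]
    {A : Matrix m m ℝ} (hA : IsPMatrix A) {x : ℝ} (hx : x ≤ 0) : A.charpoly.eval x ≠ 0 := by
  set c : ℕ → ℝ := fun k ↦ ∑ s ∈ (Finset.univ : Finset m).powersetCard k,
    (A.submatrix (Subtype.val : s → m) (Subtype.val : s → m)).det with hc
  have hc_pos : ∀ k ≤ Fintype.card m, 0 < c k := fun k hk ↦
    Finset.sum_pos (fun s _ ↦ hA s) (Finset.powersetCard_nonempty.2 (by simpa using hk))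
  have h_charpoly : (-1) ^ Fintype.card m * A.charpoly.eval x =
      ∑ k ∈ Finset.range (Fintype.card m + 1), (-x) ^ (Fintype.card m - k) * c k := by
    rw [Polynomial.eval_eq_sum_range, charpoly_natDegree_eq_dim, ← Finset.sum_range_reflect,
      Finset.mul_sum]
    refine Finset.sum_congr rfl fun k hk ↦ ?_
    have hk' : k ≤ Fintype.card m := by simpa [Nat.lt_succ_iff] using hk
    rw [Nat.add_sub_cancel, charpoly_coeff_eq_sum_minors A k hk', neg_pow x]
    have h_sign : (-1 : ℝ) ^ Fintype.card m * (-1) ^ k = (-1) ^ (Fintype.card m - k) := by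
      conv_lhs => rw [← Nat.sub_add_cancel hk', pow_add, mul_assoc, ← mul_pow]
      simp
    rw [← h_sign]
    ring
  have h_pos : 0 < ∑ k ∈ Finset.range (Fintype.card m + 1), (-x) ^ (Fintype.card m - k) * c k := by
    refine Finset.sum_pos' (fun k hk ↦ ?_) ⟨Fintype.card m, by simp, by simp [hc_pos]⟩
    exact mul_nonneg (pow_nonneg (neg_nonneg.2 hx) _)
      (hc_pos k (by simpa [Nat.lt_succ_iff] using hk)).le
  intro h0
  simp [← h_charpoly, h0] at h_pos

/-- A symmetric P-matrix is positive definite. -/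
theorem IsPMatrix.posDef {m : Type*} [Fintype m] [DecidableEq m]
    {A : Matrix m m ℝ} (hA : IsPMatrix A) (hsymm : A.IsHermitian) : A.PosDef := by
  refine hsymm.posDef_iff_eigenvalues_pos.2 fun i ↦ ?_
  by_contra! hi
  refine hA.eval_charpoly_ne_zero hi ?_
  rw [hsymm.charpoly_eq, Polynomial.eval_prod]
  exact Finset.prod_eq_zero (Finset.mem_univ i) (by simp)

/-- A positive definite matrix is a P-matrix. -/
theorem Matrix.PosDef.isPMatrix_s19 {m : Type*} [Fintype m] [DecidableEq m]
    {A : Matrix m m ℝ} (hA : A.PosDef) : IsPMatrix A := fun _ ↦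
  (hA.submatrix Subtype.val_injective).det_pos

/-- A real positive definite matrix factors as `Bᵀ * B` with `B` invertible. -/
theorem Matrix.PosDef.exists_transpose_mul_self {m : Type*} [Fintype m] [DecidableEq m]
    {A : Matrix m m ℝ} (hA : A.PosDef) :
    ∃ B : Matrix m m ℝ, IsUnit B.det ∧ A = B.transpose * B := by
  open scoped MatrixOrder Matrix.Norms.L2Operator in
  obtain ⟨B, hB⟩ := CStarAlgebra.nonneg_iff_eq_star_mul_self.mp hA.posSemidef.nonneg
  have hB' : A = B.transpose * B := by
    rw [hB, Matrix.star_eq_conjTranspose, Matrix.conjTranspose_eq_transpose_of_trivial]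
  refine ⟨B, isUnit_iff_ne_zero.2 fun h ↦ hA.det_pos.ne' ?_, hB'⟩
  rw [hB', Matrix.det_mul, h, mul_zero]

open Matrix in
/-- The variational inequality on the nonnegative orthant attached to a positive definite
matrix has a solution. -/
theorem Matrix.PosDef.exists_variational_inequality {m : Type*} [Fintype m] [DecidableEq m]
    {A : Matrix m m ℝ} (hA : A.PosDef) (b : m → ℝ) :
    ∃ z : m → ℝ, 0 ≤ z ∧ ∀ y : m → ℝ, 0 ≤ y → 0 ≤ (A *ᵥ z + b) ⬝ᵥ (y - z) := by
  obtain ⟨B, hB, rfl⟩ := hA.exists_transpose_mul_self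
  let K : Set (EuclideanSpace ℝ m) := {w | ∀ i, 0 ≤ (B⁻¹ *ᵥ w.ofLp) i}
  have hK_closed : IsClosed K := by
    simp only [K, Set.ofPred_forall]
    exact isClosed_iInter fun i ↦ isClosed_le continuous_const (by fun_prop)
  have hK_convex : Convex ℝ K := by
    intro v hv w hw s t hs ht _ i
    simp only [WithLp.ofLp_add, WithLp.ofLp_smul, mulVec_add, mulVec_smul, Pi.add_apply,
      Pi.smul_apply, smul_eq_mul]
    exact add_nonneg (mul_nonneg hs (hv i)) (mul_nonneg ht (hw i))
  have hK_mem (y : m → ℝ) (hy : 0 ≤ y) : WithLp.toLp 2 (B *ᵥ y) ∈ K := fun i ↦ by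
    simpa [mulVec_mulVec, nonsing_inv_mul B hB] using hy i
  set u : EuclideanSpace ℝ m := WithLp.toLp 2 (-(B⁻¹ᵀ *ᵥ b)) with hu
  obtain ⟨v, hvK, hv⟩ := exists_norm_eq_iInf_of_complete_convex
    ⟨_, hK_mem 0 le_rfl⟩ hK_closed.isComplete hK_convex u
  rw [norm_eq_iInf_iff_real_inner_le_zero hK_convex hvK] at hv
  refine ⟨B⁻¹ *ᵥ v.ofLp, hvK, fun y hy ↦ ?_⟩
  have h_inner := hv _ (hK_mem y hy)
  have hBv : v.ofLp = B *ᵥ (B⁻¹ *ᵥ v.ofLp) := by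
    rw [mulVec_mulVec, mul_nonsing_inv B hB, one_mulVec]
  have h_vec : (Bᵀ * B) *ᵥ (B⁻¹ *ᵥ v.ofLp) + b = -(Bᵀ *ᵥ (u.ofLp - v.ofLp)) := by
    rw [← mulVec_mulVec, ← hBv, mulVec_sub, hu]
    simp [mulVec_neg, mulVec_mulVec, ← transpose_mul, nonsing_inv_mul B hB, add_comm]
  rw [h_vec, neg_dotProduct, mulVec_transpose, ← dotProduct_mulVec, mulVec_sub, ← hBv,
    dotProduct_comm]
  simpa [EuclideanSpace.inner_eq_star_dotProduct] using h_inner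

open Matrix in
/-- A linear complementarity problem with a positive definite matrix has a unique solution. -/
theorem Matrix.PosDef.existsUnique_isLCPSolution_s19 {m : Type*} [Fintype m] [DecidableEq m]
    {A : Matrix m m ℝ} (hA : A.PosDef) (b : m → ℝ) : ∃! z : m → ℝ, IsLCPSolution A b z := by
  obtain ⟨z, hz, hvar⟩ := hA.exists_variational_inequality b
  have h_nonneg (i : m) : 0 ≤ (A *ᵥ z) i + b i := by
    simpa using hvar (z + Pi.single i 1) (add_nonneg hz (Pi.single_nonneg.2 zero_le_one))
  have h_compl (i : m) : z i * ((A *ᵥ z) i + b i) ≤ 0 := by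
    have h_le : Pi.single i (z i) ≤ z := fun j ↦ by
      obtain rfl | hj := eq_or_ne j i
      · simp
      · simpa [hj] using hz j
    have := hvar (z - Pi.single i (z i)) (sub_nonneg.2 h_le)
    simp only [sub_sub_cancel_left, dotProduct_neg, dotProduct_single, Pi.add_apply] at this
    linarith
  refine ⟨z, ⟨hz, h_nonneg, fun i ↦ (h_compl i).antisymm (mul_nonneg (hz i) (h_nonneg i))⟩, ?_⟩
  rintro y ⟨hy, hy_nonneg, hy_compl⟩
  by_contra hne
  have h_pos := hA.dotProduct_mulVec_pos (sub_ne_zero.2 hne)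
  refine h_pos.not_ge (Finset.sum_nonpos fun i _ ↦ ?_)
  simp only [star_trivial, mulVec_sub, Pi.sub_apply]
  nlinarith [h_compl i, hy_compl i, mul_nonneg (hz i) (hy_nonneg i),
    mul_nonneg (hy i) (h_nonneg i)]

/-- For symmetric layers `G⁽¹⁾, …, G⁽ᴹ⁾` with each `I + G⁽ˡ⁾` a
P-matrix, and convex weights `κ₁, …, κ_M`, the matrix `I + ∑ l, κ_l G⁽ˡ⁾` is a P-matrix,
so the M-layer multiplex network game has a unique Nash equilibrium. -/
theorem multiplex_m_layers_pMatrix {N M : ℕ} (G : Fin M → Matrix (Fin N) (Fin N) ℝ)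
    (hsym : ∀ l, (G l).IsHermitian) (hP : ∀ l, IsPMatrix (1 + G l))
    (κ : Fin M → ℝ) (hκ : ∀ l, 0 ≤ κ l) (hsum : ∑ l, κ l = 1) :
    IsPMatrix (1 + ∑ l, κ l • G l) ∧
      ∀ q : Fin N → ℝ, ∃! z : Fin N → ℝ,
        IsLCPSolution (1 + ∑ l, κ l • G l) (-q) z := by
  have h_sum : (1 + ∑ l, κ l • G l : Matrix (Fin N) (Fin N) ℝ) = ∑ l, κ l • (1 + G l) := by
    simp_rw [smul_add, Finset.sum_add_distrib, ← Finset.sum_smul, hsum, one_smul]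
  have h_posDef (l : Fin M) : (1 + G l).PosDef :=
    (hP l).posDef (Matrix.isHermitian_one.add (hsym l))
  obtain ⟨k, hk⟩ : ∃ k, 0 < κ k := by
    by_contra! h
    exact absurd hsum ((Finset.sum_nonpos fun l _ ↦ h l).trans_lt one_pos).ne
  have hA : (1 + ∑ l, κ l • G l : Matrix (Fin N) (Fin N) ℝ).PosDef := by
    rw [h_sum, ← Finset.add_sum_erase _ _ (Finset.mem_univ k)]
    exact ((h_posDef k).smul hk).add_posSemidef
      (Matrix.posSemidef_sum _ fun l _ ↦ (h_posDef l).posSemidef.smul (hκ l))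
  exact ⟨hA.isPMatrix_s19, fun q ↦ hA.existsUnique_isLCPSolution_s19 (-q)⟩
end
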